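/- If d' = d, then the sum of T(α,β)^3 over all α ∈ F_{p^m} and β ∈ F_q equals (p^{n+d} + p^n − p^d)·p^{3m}. -/

import Mathlib

open scoped BigOperators Classical

noncomputable section

/-- The map `φ_{α,β}(x) = α x^{p^m} + β x^{p^k} + β^{p^{n-k}} x^{p^{n-k}}`. -/
def phiMap (p m n k : ℕ) {F : Type} [Field F] (α β x : F) : F :=
  α * x ^ p ^ m + β * x ^ p ^ k + β ^ p ^ (n - k) * x ^ p ^ (n - k)

/-- The trace-type sum `x ↦ ∑_{i<r} x^{p^{t i}}`; for `x` in the subfield of size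
`p^{t·r}` this is the relative trace down to the subfield of size `p^t`. -/
def trSum (p t r : ℕ) {F : Type} [Field F] (x : F) : F :=
  ∑ i ∈ Finset.range r, x ^ p ^ (t * i)

/-- `ζ_p^c = exp(2πi·c̃/p)` for a lift `c̃` of `c : F_p`. -/
noncomputable def expChar (p : ℕ) (c : ZMod p) : ℂ :=
  Complex.exp (2 * Real.pi * Complex.I * (c.val : ℂ) / (p : ℂ))

/-- Identify an element of the prime field of `F` with an element of `ZMod p`
(the partial inverse of the algebra map). -/
noncomputable def fToZMod (p : ℕ) {F : Type} [Field F] [Algebra (ZMod p) F] (x : F) : ZMod p :=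
  letI : Nonempty (ZMod p) := ⟨0⟩
  Function.invFun (algebraMap (ZMod p) F) x

/-- `T(α,β) = ∑_{x ∈ F_q} ζ_p^{Tr^m_1(α x^{p^m+1}) + Tr^n_1(β x^{p^k+1})}`. -/
noncomputable def Tsum (p m n k : ℕ) (F : Type) [Field F] [Fintype F] [Algebra (ZMod p) F]
    (α β : F) : ℂ :=
  ∑ x : F, expChar p (fToZMod p (trSum p 1 m (α * x ^ (p ^ m + 1))) +
      fToZMod p (trSum p 1 n (β * x ^ (p ^ k + 1))))

/-- `S(α,β,γ) = ∑_{x ∈ F_q} ζ_p^{Tr^m_1(α x^{p^m+1}) + Tr^n_1(β x^{p^k+1} + γ x)}`. -/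
noncomputable def Ssum (p m n k : ℕ) (F : Type) [Field F] [Fintype F] [Algebra (ZMod p) F]
    (α β γ : F) : ℂ :=
  ∑ x : F, expChar p (fToZMod p (trSum p 1 m (α * x ^ (p ^ m + 1))) +
      fToZMod p (trSum p 1 n (β * x ^ (p ^ k + 1) + γ * x)))

/-- `√(q₀*)` where `q₀* = (−1)^{(q₀−1)/2} q₀`. -/
noncomputable def sqrtStar (q0 : ℕ) : ℂ :=
  if q0 % 4 = 1 then (Real.sqrt q0 : ℂ) else Complex.I * (Real.sqrt q0 : ℂ)

/-- `ζ_p = exp(2πi/p)`. -/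
noncomputable def zetaC (p : ℕ) : ℂ := Complex.exp (2 * Real.pi * Complex.I / (p : ℂ))

/-- Number of pairs `(α,β) ∈ F_{p^m} × F_q` with `T(α,β) = v`. -/
noncomputable def Tcount (p m n k : ℕ) (F : Type) [Field F] [Fintype F] [Algebra (ZMod p) F]
    (v : ℂ) : ℕ :=
  Nat.card {ab : F × F // ab.1 ^ p ^ m = ab.1 ∧ Tsum p m n k F ab.1 ab.2 = v}

/-- Number of triples `(α,β,γ) ∈ F_{p^m} × F_q × F_q` with `S(α,β,γ) = v`. -/
noncomputable def Scount (p m n k : ℕ) (F : Type) [Field F] [Fintype F] [Algebra (ZMod p) F]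
    (v : ℂ) : ℕ :=
  Nat.card {abc : F × F × F // abc.1 ^ p ^ m = abc.1 ∧ Ssum p m n k F abc.1 abc.2.1 abc.2.2 = v}

/-- Hamming weight of the codeword of `C₁` attached to `(α,β)`:
the number of `0 ≤ i ≤ q-2` with `Tr^m_t(α π^{i(p^m+1)}) + Tr^n_t(β π^{i(p^k+1)}) ≠ 0`. -/
noncomputable def wt1 (p m n k t : ℕ) {F : Type} [Field F] (π α β : F) : ℕ :=
  Nat.card {i : ℕ // i ≤ p ^ n - 2 ∧
    trSum p t (m / t) (α * π ^ (i * (p ^ m + 1))) +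
    trSum p t (n / t) (β * π ^ (i * (p ^ k + 1))) ≠ 0}

/-- Number of pairs `(α,β) ∈ F_{p^m} × F_q` whose `C₁`-codeword has weight `v`. -/
noncomputable def wt1count (p m n k t : ℕ) (F : Type) [Field F] [Fintype F] (π : F) (v : ℕ) : ℕ :=
  Nat.card {ab : F × F // ab.1 ^ p ^ m = ab.1 ∧ wt1 p m n k t π ab.1 ab.2 = v}

/-- Hamming weight of the codeword of `C₂` attached to `(α,β,γ)`. -/
noncomputable def wt2 (p m n k t : ℕ) {F : Type} [Field F] (π α β γ : F) : ℕ :=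
  Nat.card {i : ℕ // i ≤ p ^ n - 2 ∧
    trSum p t (m / t) (α * π ^ (i * (p ^ m + 1))) +
    trSum p t (n / t) (β * π ^ (i * (p ^ k + 1)) + γ * π ^ i) ≠ 0}

/-- Number of triples `(α,β,γ)` whose `C₂`-codeword has weight `v`. -/
noncomputable def wt2count (p m n k t : ℕ) (F : Type) [Field F] [Fintype F] (π : F) (v : ℕ) : ℕ :=
  Nat.card {abc : F × F × F // abc.1 ^ p ^ m = abc.1 ∧ wt2 p m n k t π abc.1 abc.2.1 abc.2.2 = v}

/-- The subfield of `F` fixed by the `r`-th power of Frobenius. -/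
def frobFixed (p r : ℕ) (F : Type) [Field F] [ExpChar F p] : Subfield F :=
  (iterateFrobenius F p r).eqLocusField (RingHom.id F)

theorem mem_frobFixed {p r : ℕ} {F : Type} [Field F] [ExpChar F p] {x : F} :
    x ∈ frobFixed p r F ↔ x ^ p ^ r = x :=
  Iff.rfl

theorem mem_frobFixed_iff_isPeriodicPt {p r : ℕ} {F : Type} [Field F] [ExpChar F p] {x : F} :
    x ∈ frobFixed p r F ↔ Function.IsPeriodicPt (fun y : F => y ^ p) r x := by
  rw [mem_frobFixed, Function.IsPeriodicPt, Function.IsFixedPt, pow_iterate]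

theorem mem_frobFixed_of_card {p n : ℕ} {F : Type} [Field F] [Fintype F] [ExpChar F p]
    (hF : Fintype.card F = p ^ n) (x : F) : x ∈ frobFixed p n F := by
  rw [mem_frobFixed, ← hF, FiniteField.pow_card]

theorem card_frobFixed {p n r : ℕ} {F : Type} [Field F] [Fintype F] [ExpChar F p]
    (hp : p.Prime) (hF : Fintype.card F = p ^ n) (hrn : r ∣ n) (hr : 0 < r) :
    Nat.card (frobFixed p r F) = p ^ r := by
  have hpr : 1 < p ^ r := Nat.one_lt_pow hr.ne' hp.one_lt
  have hker := IsCyclic.card_powMonoidHom_ker (G := Fˣ) (p ^ r - 1)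
  have hdvd : p ^ r - 1 ∣ p ^ n - 1 := by
    obtain ⟨s, rfl⟩ := hrn
    rw [pow_mul]
    exact Nat.sub_one_dvd_pow_sub_one _ _
  rw [Nat.card_units, (Nat.card_eq_fintype_card (α := F)).trans hF, Nat.gcd_eq_right hdvd] at hker
  have e : (frobFixed p r F)ˣ ≃ (powMonoidHom (p ^ r - 1) : Fˣ →* Fˣ).ker :=
    { toFun := fun u => ⟨Units.map (frobFixed p r F).subtype.toMonoidHom u, by
        have h : ((u : frobFixed p r F) : F) ^ p ^ r = u := u.1.2
        have h0 : ((u : frobFixed p r F) : F) ≠ 0 := by simp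
        rw [MonoidHom.mem_ker]
        ext
        simp only [powMonoidHom_apply, Units.val_pow_eq_pow_val, Units.val_one]
        change ((u : frobFixed p r F) : F) ^ (p ^ r - 1) = 1
        apply mul_right_cancel₀ h0
        rw [pow_sub_one_mul (zero_lt_one.trans hpr).ne', h, one_mul]⟩
      invFun := fun v => Units.mk0 ⟨(v.1 : F), by
        have h := congrArg Units.val (MonoidHom.mem_ker.mp v.2)
        simp only [powMonoidHom_apply, Units.val_pow_eq_pow_val, Units.val_one] at h
        rw [mem_frobFixed, ← pow_sub_one_mul (zero_lt_one.trans hpr).ne', h, one_mul]⟩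
        (by simp [Subtype.ext_iff])
      left_inv := fun u => by ext; rfl
      right_inv := fun v => by ext; rfl }
  have h1 := Nat.card_congr e
  rw [hker, Nat.card_units] at h1
  have h2 : 0 < Nat.card (frobFixed p r F) := Nat.card_pos
  omega

theorem algebraMap_fToZMod {p : ℕ} {F : Type} [Field F] [Algebra (ZMod p) F] [Fact p.Prime]
    {x : F} (hx : x ^ p = x) : algebraMap (ZMod p) F (fToZMod p x) = x := by
  have : CharP F p := charP_of_injective_algebraMap (algebraMap (ZMod p) F).injective p
  have hmem : x ∈ (⊥ : Subfield F) := (Subfield.mem_bot_iff_pow_eq_self (p := p) F).2 hx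
  rw [← ZMod.fieldRange_castHom_eq_bot p] at hmem
  obtain ⟨y, hy⟩ := hmem
  exact Function.invFun_eq ⟨y, (RingHom.congr_fun (Subsingleton.elim _ _) y).trans hy⟩

theorem trSum_add {p r : ℕ} {F : Type} [Field F] [ExpChar F p] (x y : F) :
    trSum p 1 r (x + y) = trSum p 1 r x + trSum p 1 r y := by
  simp only [trSum, add_pow_expChar_pow, Finset.sum_add_distrib]

theorem trSum_pow_char {p r : ℕ} {F : Type} [Field F] [ExpChar F p] {x : F}
    (hx : x ∈ frobFixed p r F) : trSum p 1 r x ^ p = trSum p 1 r x := by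
  rw [mem_frobFixed] at hx
  have h := Finset.sum_range_succ' (fun i => x ^ p ^ i) r
  rw [Finset.sum_range_succ, hx, pow_zero, pow_one, add_left_inj] at h
  simp only [trSum, one_mul]
  rw [sum_pow_char]
  simp only [← pow_mul, ← pow_succ]
  exact h.symm

theorem expChar_eq_stdAddChar {p : ℕ} [NeZero p] (c : ZMod p) :
    expChar p c = ZMod.stdAddChar c := by
  rw [ZMod.stdAddChar_apply, ZMod.toCircle_apply, expChar]

section Character

variable (p r : ℕ) (F : Type) [Field F] [Algebra (ZMod p) F] [Fact p.Prime] [ExpChar F p]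

/-- The trace character of the subfield of `F` fixed by the `r`-th power of Frobenius. -/
def traceChar : AddChar (frobFixed p r F) ℂ where
  toFun x := expChar p (fToZMod p (trSum p 1 r (x : F)))
  map_zero_eq_one' := by
    have h : fToZMod p (trSum p 1 r (0 : F)) = 0 := by
      apply (algebraMap (ZMod p) F).injective
      have h0 := trSum_pow_char (frobFixed p r F).zero_mem
      rw [algebraMap_fToZMod h0, map_zero]
      simp [trSum, (Fact.out : p.Prime).ne_zero]
    rw [ZeroMemClass.coe_zero, h, expChar_eq_stdAddChar, AddChar.map_zero_eq_one]
  map_add_eq_mul' x y := by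
    rw [expChar_eq_stdAddChar, expChar_eq_stdAddChar, expChar_eq_stdAddChar,
      ← AddChar.map_add_eq_mul]
    congr 1
    apply (algebraMap (ZMod p) F).injective
    rw [map_add, algebraMap_fToZMod (trSum_pow_char x.2), algebraMap_fToZMod (trSum_pow_char y.2),
      algebraMap_fToZMod (trSum_pow_char (x + y).2), ← trSum_add]
    rfl

variable {p r F}

theorem traceChar_apply (x : frobFixed p r F) :
    traceChar p r F x = expChar p (fToZMod p (trSum p 1 r (x : F))) :=
  rfl

theorem traceChar_isPrimitive [Finite F] (hr : 0 < r)
    (hcard : Nat.card (frobFixed p r F) = p ^ r) : (traceChar p r F).IsPrimitive := by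
  have hp : p.Prime := Fact.out
  apply AddChar.IsPrimitive.of_ne_one
  intro h1
  have htr : ∀ x : frobFixed p r F, trSum p 1 r (x : F) = 0 := by
    intro x
    have hx : traceChar p r F x = 1 := by rw [h1, AddChar.one_apply]
    rw [traceChar_apply, expChar_eq_stdAddChar,
      ← AddChar.map_zero_eq_one (ZMod.stdAddChar (N := p)), ZMod.injective_stdAddChar.eq_iff] at hx
    rw [← algebraMap_fToZMod (trSum_pow_char x.2), hx, map_zero]
  obtain ⟨s, rfl⟩ : ∃ s, r = s + 1 := ⟨r - 1, by omega⟩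
  let f : Polynomial F := ∑ i ∈ Finset.range (s + 1), Polynomial.X ^ p ^ i
  have hcoeff : f.coeff (p ^ s) = 1 := by
    simp only [f, Polynomial.finsetSum_coeff, Polynomial.coeff_X_pow]
    rw [Finset.sum_eq_single s]
    · simp
    · intro i _ his
      rw [if_neg]
      exact fun h => his (Nat.pow_right_injective hp.two_le h).symm
    · simp
  have hf0 : f ≠ 0 := by
    intro h
    simp [h] at hcoeff
  have hdeg : f.natDegree ≤ p ^ s := by
    refine Polynomial.natDegree_sum_le_of_forall_le _ _ fun i hi => ?_
    rw [Polynomial.natDegree_X_pow]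
    exact Nat.pow_le_pow_right hp.pos (Nat.lt_succ_iff.mp (Finset.mem_range.mp hi))
  have hsub : (frobFixed p (s + 1) F : Set F) ⊆ (f.roots.toFinset : Set F) := by
    intro x hx
    have h := htr ⟨x, hx⟩
    simp only [trSum, one_mul] at h
    simp [hf0, Polynomial.IsRoot, f, Polynomial.eval_finsetSum, h]
  have h1 := Set.ncard_le_ncard hsub (Finset.finite_toSet _)
  rw [Set.ncard_coe_finset] at h1
  have h2 : (frobFixed p (s + 1) F : Set F).ncard = p ^ (s + 1) := hcard
  have h3 := (Multiset.toFinset_card_le f.roots).trans (Polynomial.card_roots' f)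
  have h4 : p ^ s < p ^ (s + 1) := Nat.pow_lt_pow_right hp.one_lt (Nat.lt_succ_self s)
  omega

end Character

/-- A point `(1, t, w)` isotropic for the twists by `σ` and `τ` of the form `u t + t u + 2 w w` is
fixed by `σ ∘ τ`. -/
theorem fixed_of_isotropic {F : Type} [Field F] (h2 : (2 : F) ≠ 0) (σ τ : F →+* F)
    (hσ : ∀ x, σ (σ x) = x) (hστ : ∀ x, σ (τ x) = τ (σ x)) {t w : F}
    (h₁ : t + σ t + 2 * (w * σ w) = 0) (h₃ : t + τ t + 2 * (w * τ w) = 0) :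
    σ (τ w) = w ∧ σ (τ t) = t := by
  have hτ₁ := congrArg τ h₁
  have hσ₃ := congrArg σ h₃
  simp only [map_add, map_mul, map_zero, map_ofNat] at hτ₁ hσ₃
  rw [← hστ, ← hστ] at hτ₁
  have hw : σ (τ w) = w := by
    have hprod : (w - σ (τ w)) * (σ w - τ w) = 0 := by
      apply mul_left_cancel₀ h2
      linear_combination h₁ - h₃ + hτ₁ - hσ₃
    rcases mul_eq_zero.mp hprod with h | h
    · exact (sub_eq_zero.mp h).symm
    · rw [← sub_eq_zero.mp h, hσ]
  refine ⟨hw, ?_⟩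
  rw [hw] at hτ₁
  linear_combination hτ₁ - h₃

/-- Solutions of the pair of diagonal equations `x^(p^j+1) + y^(p^j+1) + z^(p^j+1) = 0`
for `j = m, k`. -/
def conicSet (p m k : ℕ) (F : Type) [Field F] : Set (F × F × F) :=
  {v | v.1 ^ (p ^ m + 1) + v.2.1 ^ (p ^ m + 1) + v.2.2 ^ (p ^ m + 1) = 0 ∧
    v.1 ^ (p ^ k + 1) + v.2.1 ^ (p ^ k + 1) + v.2.2 ^ (p ^ k + 1) = 0}

/-- Parametrisation of the cone over the rational points of `x² + y² + z² = 0`, for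
`a² + b² = -1`. -/
def conicParam {F : Type} [Field F] (K : Subfield F) (a b : F) : F ⊕ (Fˣ × K) → F × F × F
  | .inl t => (a * t, b * t, -t)
  | .inr (u, κ) => (u * (a * (1 - (κ : F) ^ 2) + 2 * b * κ),
      u * (b * (1 - (κ : F) ^ 2) - 2 * a * κ), u * (1 + (κ : F) ^ 2))

theorem conicParam_injective {F : Type} [Field F] (h2 : (2 : F) ≠ 0) (K : Subfield F) {a b : F}
    (hab : a ^ 2 + b ^ 2 = -1) : Function.Injective (conicParam K a b) := by
  rintro (t | ⟨u, κ⟩) (t' | ⟨u', κ'⟩) h <;>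
    simp only [conicParam, Prod.mk.injEq] at h <;> obtain ⟨hx, hy, hz⟩ := h
  · rw [neg_injective hz]
  · exfalso
    apply u'.ne_zero
    apply mul_left_cancel₀ h2
    linear_combination a * hx + b * hy - hz - (t + u' * (κ' ^ 2 - 1)) * hab
  · exfalso
    apply u.ne_zero
    apply mul_left_cancel₀ h2
    linear_combination - a * hx - b * hy + hz - (t' + u * (κ ^ 2 - 1)) * hab
  · have hu : (u : F) = u' := by
      apply mul_left_cancel₀ h2
      linear_combination - a * hx - b * hy + hz +
        (u * (1 - κ ^ 2) - u' * (1 - κ' ^ 2)) * hab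
    have hκ : (κ : F) = κ' := by
      apply mul_left_cancel₀ (mul_ne_zero h2 u.ne_zero)
      linear_combination - b * hx + a * hy + 2 * (u * κ - u' * κ') * hab - 2 * κ' * hu
    rw [Units.ext hu, Subtype.ext hκ]

theorem twistedForm_eq {F : Type} [Field F] (σ : F →+* F) {a b : F} (ha : σ a = a) (hb : σ b = b)
    (hab : a ^ 2 + b ^ 2 = -1) (u t w : F) :
    (a * (u + t) + 2 * b * w) * σ (a * (u + t) + 2 * b * w) +
      (b * (u + t) - 2 * a * w) * σ (b * (u + t) - 2 * a * w) + (u - t) * σ (u - t) =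
      -2 * (u * σ t + t * σ u + 2 * (w * σ w)) := by
  simp only [map_add, map_sub, map_mul, map_ofNat, ha, hb]
  linear_combination ((u + t) * (σ u + σ t) + 4 * (w * σ w)) * hab

theorem range_conicParam {p m n k d : ℕ} {F : Type} [Field F] [Fintype F] [ExpChar F p]
    (h2 : (2 : F) ≠ 0) (hn : n = 2 * m) (hF : Fintype.card F = p ^ n)
    (hd : d = Nat.gcd m k) (hd' : d = Nat.gcd (m + k) (2 * k)) {a b : F}
    (ha : a ^ p = a) (hb : b ^ p = b) (hab : a ^ 2 + b ^ 2 = -1) :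
    Set.range (conicParam (frobFixed p d F) a b) = conicSet p m k F := by
  have hfix : ∀ {c : F}, c ^ p = c → ∀ j, iterateFrobenius F p j c = c := by
    intro c hc j
    have h : Function.IsPeriodicPt (fun y : F => y ^ p) (1 * j) c :=
      Function.IsPeriodicPt.mul_const (mem_frobFixed_iff_isPeriodicPt.1 (by
        rw [mem_frobFixed, pow_one, hc])) j
    rw [one_mul] at h
    exact mem_frobFixed_iff_isPeriodicPt.2 h
  have hK : ∀ {c : F}, c ∈ frobFixed p d F → ∀ {j}, d ∣ j → iterateFrobenius F p j c = c :=
    fun hc _ hj => mem_frobFixed_iff_isPeriodicPt.2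
      ((mem_frobFixed_iff_isPeriodicPt.1 hc).trans_dvd hj)
  have hdm : d ∣ m := hd ▸ Nat.gcd_dvd_left m k
  have hdk : d ∣ k := hd ▸ Nat.gcd_dvd_right m k
  have hform : ∀ j, ∀ u t w : F,
      (a * (u + t) + 2 * b * w) ^ (p ^ j + 1) + (b * (u + t) - 2 * a * w) ^ (p ^ j + 1) +
        (u - t) ^ (p ^ j + 1) = 0 ↔
      u * iterateFrobenius F p j t + t * iterateFrobenius F p j u +
        2 * (w * iterateFrobenius F p j w) = 0 := by
    intro j u t w
    have h := twistedForm_eq (iterateFrobenius F p j) (hfix ha j) (hfix hb j) hab u t w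
    simp only [iterateFrobenius_def, ← pow_succ'] at h ⊢
    rw [h, mul_eq_zero, or_iff_right (neg_ne_zero.2 h2)]
  ext ⟨x, y, z⟩
  constructor
  · rintro ⟨t | ⟨u, κ, hκ⟩, hv⟩
    · simp only [conicParam, Prod.mk.injEq] at hv
      obtain ⟨rfl, rfl, rfl⟩ := hv
      have h : ∀ j, _ := fun j => (hform j 0 t 0).2 (by simp)
      simp only [zero_add, mul_zero, add_zero, sub_zero, zero_sub] at h
      exact ⟨h m, h k⟩
    · simp only [conicParam, Prod.mk.injEq] at hv
      obtain ⟨rfl, rfl, rfl⟩ := hv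
      have h : ∀ j, d ∣ j → _ := fun j hj => (hform j (u : F) (-(u * κ ^ 2)) (u * κ)).2 (by
        simp only [map_neg, map_mul, map_pow, hK hκ hj]
        ring)
      have e₁ : (u : F) * (a * (1 - κ ^ 2) + 2 * b * κ) =
        a * (u + -(u * κ ^ 2)) + 2 * b * (u * κ) := by ring
      have e₂ : (u : F) * (b * (1 - κ ^ 2) - 2 * a * κ) =
        b * (u + -(u * κ ^ 2)) - 2 * a * (u * κ) := by ring
      have e₃ : (u : F) * (1 + κ ^ 2) = u - -(u * κ ^ 2) := by ring
      simp only [e₁, e₂, e₃]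
      exact ⟨h m hdm, h k hdk⟩
  · rintro ⟨hm', hk'⟩
    obtain ⟨u, t, w, rfl, rfl, rfl⟩ : ∃ u t w : F, x = a * (u + t) + 2 * b * w ∧
        y = b * (u + t) - 2 * a * w ∧ z = u - t := by
      refine ⟨(-(a * x + b * y) + z) / 2, (-(a * x + b * y) - z) / 2, -(b * x - a * y) / 2,
        ?_, ?_, ?_⟩ <;> field_simp
      · linear_combination 2 * x * hab
      · linear_combination 2 * y * hab
      · ring
    simp only [hform] at hm' hk'
    by_cases hu : u = 0
    · subst hu
      have hw : w = 0 := by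
        simpa only [map_zero, zero_mul, mul_zero, zero_add, mul_eq_zero, h2, false_or,
          map_eq_zero, or_self] using hm'
      subst hw
      exact ⟨.inl t, by simp [conicParam]⟩
    · have hu' : ∀ j, iterateFrobenius F p j u ≠ 0 := fun j =>
        (map_ne_zero (iterateFrobenius F p j)).2 hu
      have hscale : ∀ j, u * iterateFrobenius F p j t + t * iterateFrobenius F p j u +
          2 * (w * iterateFrobenius F p j w) = 0 →
          t / u + iterateFrobenius F p j (t / u) +
            2 * (w / u * iterateFrobenius F p j (w / u)) = 0 := by
        intro j h
        have := hu' j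
        rw [map_div₀, map_div₀]
        field_simp
        linear_combination h
      have hcomp : ∀ i j, ∀ c : F, iterateFrobenius F p i (iterateFrobenius F p j c) =
          iterateFrobenius F p (i + j) c := fun i j c => (iterateFrobenius_add_apply F p i j c).symm
      have hinv : ∀ c : F, iterateFrobenius F p n c = c := mem_frobFixed_of_card hF
      have hσ : ∀ c : F, iterateFrobenius F p m (iterateFrobenius F p m c) = c := by
        intro c
        rw [hcomp, ← two_mul, ← hn, hinv]
      have hcomm : ∀ c : F, iterateFrobenius F p m (iterateFrobenius F p k c) =
          iterateFrobenius F p k (iterateFrobenius F p m c) := by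
        intro c
        rw [hcomp, hcomp, add_comm]
      obtain ⟨hw, ht⟩ := fixed_of_isotropic h2 _ _ hσ hcomm (hscale m hm') (hscale k hk')
      rw [hcomp] at hw ht
      have hgcd : Nat.gcd (m + k) n ∣ d := by
        rw [hd', hn]
        refine Nat.dvd_gcd (Nat.gcd_dvd_left _ _) ?_
        have h := (Nat.dvd_add_right (Nat.gcd_dvd_right (m + k) (2 * m))).1
          (show _ ∣ 2 * m + 2 * k by
            rw [← mul_add]
            exact (Nat.gcd_dvd_left _ _).mul_left 2)
        exact h
      have hmem : ∀ c : F, iterateFrobenius F p (m + k) c = c → c ∈ frobFixed p d F := by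
        intro c hc
        exact mem_frobFixed_iff_isPeriodicPt.2
          (((mem_frobFixed_iff_isPeriodicPt.1 hc).gcd
            (mem_frobFixed_iff_isPeriodicPt.1 (hinv c))).trans_dvd hgcd)
      have ht2 := hscale m hm'
      rw [hK (hmem _ hw) hdm, hK (hmem _ ht) hdm] at ht2
      have ht3 : t / u = -(w / u) ^ 2 := by
        apply mul_left_cancel₀ h2
        linear_combination ht2
      have ht4 : t = -u * (w / u) ^ 2 := by
        rw [neg_mul, ← mul_neg, ← ht3]
        field_simp
      have hw4 : w = u * (w / u) := by field_simp
      refine ⟨.inr (Units.mk0 u hu, ⟨w / u, hmem _ hw⟩), ?_⟩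
      simp only [conicParam, Units.val_mk0, Prod.mk.injEq]
      refine ⟨?_, ?_, ?_⟩
      · linear_combination -a * ht4 - 2 * b * hw4
      · linear_combination -b * ht4 + 2 * a * hw4
      · linear_combination ht4

theorem card_conicSet {p m n k d : ℕ} {F : Type} [Field F] [Fintype F] [Algebra (ZMod p) F]
    (hp : p.Prime) (hodd : p % 2 = 1) (hm : 0 < m)
    (hn : n = 2 * m) (hF : Fintype.card F = p ^ n)
    (hd : d = Nat.gcd m k) (hd' : d = Nat.gcd (m + k) (2 * k)) :
    Nat.card (conicSet p m k F) = p ^ n + (p ^ n - 1) * p ^ d := by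
  have : Fact p.Prime := ⟨hp⟩
  have : CharP F p := charP_of_injective_algebraMap (algebraMap (ZMod p) F).injective p
  have h2 : (2 : F) ≠ 0 := Ring.two_ne_zero (by
    rw [ringChar.eq F p]
    rintro rfl
    simp at hodd)
  obtain ⟨a, b, hab⟩ := ZMod.sq_add_sq p (-1)
  have hfix : ∀ c : ZMod p, algebraMap (ZMod p) F c ^ p = algebraMap (ZMod p) F c := fun c => by
    rw [← map_pow, ZMod.pow_card]
  have hab' : algebraMap (ZMod p) F a ^ 2 + algebraMap (ZMod p) F b ^ 2 = -1 := by
    rw [← map_pow, ← map_pow, ← map_add, hab, map_neg, map_one]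
  have hdpos : 0 < d := hd ▸ Nat.gcd_pos_of_pos_left k hm
  have hdn : d ∣ n := by
    rw [hn, hd]
    exact (Nat.gcd_dvd_left m k).mul_left 2
  rw [← range_conicParam h2 hn hF hd hd' (hfix a) (hfix b) hab',
    ← Nat.card_congr (Equiv.ofInjective _ (conicParam_injective h2 _ hab')), Nat.card_sum,
    Nat.card_prod, Nat.card_units, card_frobFixed hp hF hdn hdpos, Nat.card_eq_fintype_card, hF]

theorem stmt5 (p m k n d d' : ℕ) (hp : Nat.Prime p) (hodd : p % 2 = 1)
    (hm : 0 < m) (hn : n = 2 * m) (hk : k ≤ n - 1) (hkm : k ≠ m)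
    (hd : d = Nat.gcd m k) (hd' : d' = Nat.gcd (m + k) (2 * k))
    (F : Type) [Field F] [Fintype F] [Algebra (ZMod p) F] (hF : Fintype.card F = p ^ n) (hcase : d' = d) :
    ∑ α : {a : F // a ^ p ^ m = a}, ∑ β : F, (Tsum p m n k F α.1 β) ^ 3
      = ((p : ℂ) ^ (n + d) + (p : ℂ) ^ n - (p : ℂ) ^ d) * (p : ℂ) ^ (3 * m) := by
  subst hcase
  have : Fact p.Prime := ⟨hp⟩
  have : CharP F p := charP_of_injective_algebraMap (algebraMap (ZMod p) F).injective p
  have hn0 : 0 < n := by omega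
  have hfrob : ∀ x : F, x ^ p ^ n = x := mem_frobFixed_of_card hF
  have hnorm : ∀ x : F, x ^ (p ^ m + 1) ∈ frobFixed p m F := by
    intro x
    rw [mem_frobFixed, ← pow_mul, add_mul, ← pow_add, ← two_mul, ← hn, one_mul, pow_add, hfrob,
      pow_succ']
  let A : F → frobFixed p m F := fun x => ⟨x ^ (p ^ m + 1), hnorm x⟩
  let B : F → frobFixed p n F := fun x => ⟨x ^ (p ^ k + 1), mem_frobFixed_of_card hF _⟩
  have hcardm := card_frobFixed hp hF (hn ▸ Dvd.intro_left 2 rfl) hm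
  have hcardn := card_frobFixed hp hF (dvd_refl n) hn0
  have hT : ∀ (α : frobFixed p m F) (β : frobFixed p n F), Tsum p m n k F α β =
      ∑ x, traceChar p m F (α * A x) * traceChar p n F (β * B x) := by
    intro α β
    refine Finset.sum_congr rfl fun x _ => ?_
    rw [expChar_eq_stdAddChar, AddChar.map_add_eq_mul, ← expChar_eq_stdAddChar,
      ← expChar_eq_stdAddChar]
    rfl
  have hcube : ∀ (α : frobFixed p m F) (β : frobFixed p n F), Tsum p m n k F α β ^ 3 =
      ∑ v : F × F × F, traceChar p m F (α * (A v.1 + A v.2.1 + A v.2.2)) *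
        traceChar p n F (β * (B v.1 + B v.2.1 + B v.2.2)) := by
    intro α β
    rw [hT, pow_three]
    simp only [Finset.sum_mul, Finset.mul_sum, Fintype.sum_prod_type, mul_add,
      AddChar.map_add_eq_mul]
    refine Finset.sum_congr rfl fun x _ => Finset.sum_congr rfl fun y _ =>
      Finset.sum_congr rfl fun z _ => ?_
    ring
  have hA : ∀ c : frobFixed p m F, ∑ α, traceChar p m F (α * c) =
      if c = 0 then (p : ℂ) ^ m else 0 := by
    intro c
    rw [AddChar.sum_mulShift c (traceChar_isPrimitive hm hcardm), ← Nat.card_eq_fintype_card,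
      hcardm, Nat.cast_ite, Nat.cast_pow, Nat.cast_zero]
  have hB : ∀ c : frobFixed p n F, ∑ β, traceChar p n F (β * c) =
      if c = 0 then (p : ℂ) ^ n else 0 := by
    intro c
    rw [AddChar.sum_mulShift c (traceChar_isPrimitive hn0 hcardn), ← Nat.card_eq_fintype_card,
      hcardn, Nat.cast_ite, Nat.cast_pow, Nat.cast_zero]
  let e : frobFixed p n F ≃ F := Equiv.subtypeUnivEquiv (mem_frobFixed_of_card hF)
  have hmain : ∑ α : {a : F // a ^ p ^ m = a}, ∑ β : F, Tsum p m n k F α.1 β ^ 3 =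
      ∑ α : frobFixed p m F, ∑ β : frobFixed p n F, Tsum p m n k F α β ^ 3 :=
    Fintype.sum_equiv (Equiv.refl _) _ _ fun α =>
      (Fintype.sum_equiv e _ _ fun β => rfl).symm
  have hsol : ∀ v : F × F × F,
      ((if A v.1 + A v.2.1 + A v.2.2 = 0 then (p : ℂ) ^ m else 0) *
        if B v.1 + B v.2.1 + B v.2.2 = 0 then (p : ℂ) ^ n else 0) =
      if v ∈ conicSet p m k F then (p : ℂ) ^ (3 * m) else 0 := by
    intro v
    have h1 : A v.1 + A v.2.1 + A v.2.2 = 0 ↔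
        v.1 ^ (p ^ m + 1) + v.2.1 ^ (p ^ m + 1) + v.2.2 ^ (p ^ m + 1) = 0 := Subtype.ext_iff
    have h2 : B v.1 + B v.2.1 + B v.2.2 = 0 ↔
        v.1 ^ (p ^ k + 1) + v.2.1 ^ (p ^ k + 1) + v.2.2 ^ (p ^ k + 1) = 0 := Subtype.ext_iff
    have h3 : (p : ℂ) ^ (3 * m) = (p : ℂ) ^ m * (p : ℂ) ^ n := by
      rw [← pow_add, hn]
      congr 1
      ring
    rw [ite_zero_mul_ite_zero, h3]
    exact if_congr (and_congr h1 h2) rfl rfl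
  have hcard := card_conicSet (k := k) hp hodd hm hn hF hd hd'
  calc ∑ α : {a : F // a ^ p ^ m = a}, ∑ β : F, Tsum p m n k F α.1 β ^ 3
      = ∑ v : F × F × F, ∑ α : frobFixed p m F, ∑ β : frobFixed p n F,
          traceChar p m F (α * (A v.1 + A v.2.1 + A v.2.2)) *
            traceChar p n F (β * (B v.1 + B v.2.1 + B v.2.2)) := by
        rw [hmain]
        simp only [hcube]
        exact (Finset.sum_congr rfl fun α _ => Finset.sum_comm).trans Finset.sum_comm
    _ = ∑ v : F × F × F, if v ∈ conicSet p m k F then (p : ℂ) ^ (3 * m) else 0 := by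
        refine Finset.sum_congr rfl fun v _ => ?_
        rw [← Finset.sum_mul_sum, hA, hB, hsol]
    _ = (Nat.card (conicSet p m k F) : ℂ) * (p : ℂ) ^ (3 * m) := by
        rw [← Finset.sum_filter, Finset.sum_const, nsmul_eq_mul, Nat.card_eq_fintype_card,
          Fintype.card_subtype]
    _ = _ := by
        rw [hcard]
        push_cast [Nat.cast_sub (Nat.one_le_pow n p hp.pos)]
        ring
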